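/- arXiv:2510.08320 — 3 statements merged into one kernel-verified Lean document; each statement's English description precedes it below -/
import Mathlib

section
/- Let n ≥ 1 and let ρ and σ be density matrices on ℂ^D. Define the joint final state on (ℂ^D)^{⊗(2n-1)} = (ℂ^D)^{⊗n} ⊗ (ℂ^D)^{⊗(n-1)} by τ_full = (1/n) · [ ρ^{⊗n} ⊗ σ^{⊗(n-1)} + Σ_{i=0}^{n-2} σ^{⊗n} ⊗ ρ^{⊗(i+1)} ⊗ σ^{⊗(n-2-i)} ]. Then the partial trace of τ_full over the first n factors equals the catalyst ω = (1/n) · Σ_{i=0}^{n-1} ρ^{⊗i} ⊗ σ^{⊗(n-1-i)}; i.e. the catalyst is returned exactly in its initial state. -/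
open Matrix
open scoped Kronecker ComplexOrder

/-- Tensor (Kronecker) product of a family of `D × D` matrices, acting on
`(ℂ^D)^{⊗ k}` whose index set is identified with `Fin k → Fin D`. -/
noncomputable def tensFam {D k : ℕ} (M : Fin k → Matrix (Fin D) (Fin D) ℂ) :
    Matrix (Fin k → Fin D) (Fin k → Fin D) ℂ :=
  Matrix.of fun x y => ∏ j, M j (x j) (y j)

/-- `k`-fold tensor power of a `D × D` matrix. -/
noncomputable def tensPow {D : ℕ} (k : ℕ) (ρ : Matrix (Fin D) (Fin D) ℂ) :
    Matrix (Fin k → Fin D) (Fin k → Fin D) ℂ :=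
  tensFam (fun _ : Fin k => ρ)

/-- The joint final state
`τ_full = (1/n) [ ρ^{⊗n} ⊗ σ^{⊗(n-1)} + Σ_{i=0}^{n-2} σ^{⊗n} ⊗ ρ^{⊗(i+1)} ⊗ σ^{⊗(n-2-i)} ]`
on `(ℂ^D)^{⊗ n} ⊗ (ℂ^D)^{⊗ (n-1)}` (output registers ⊗ catalyst registers). -/
noncomputable def tauFull {D : ℕ} (n : ℕ) (ρ σ : Matrix (Fin D) (Fin D) ℂ) :
    Matrix ((Fin n → Fin D) × (Fin (n - 1) → Fin D))
           ((Fin n → Fin D) × (Fin (n - 1) → Fin D)) ℂ :=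
  ((n : ℂ)⁻¹) • ((tensPow n ρ) ⊗ₖ (tensPow (n - 1) σ)
    + ∑ i ∈ Finset.range (n - 1),
        (tensPow n σ) ⊗ₖ tensFam (fun j : Fin (n - 1) => if (j : ℕ) < i + 1 then ρ else σ))

/-- Partial trace over the first (output) registers. -/
noncomputable def ptraceL {D n m : ℕ}
    (M : Matrix ((Fin n → Fin D) × (Fin m → Fin D))
                ((Fin n → Fin D) × (Fin m → Fin D)) ℂ) :
    Matrix (Fin m → Fin D) (Fin m → Fin D) ℂ :=
  Matrix.of fun y y' => ∑ x : Fin n → Fin D, M (x, y) (x, y')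

@[simp]
lemma tensFam_apply {D k : ℕ} (M : Fin k → Matrix (Fin D) (Fin D) ℂ) (x y : Fin k → Fin D) :
    tensFam M x y = ∏ j, M j (x j) (y j) := rfl

lemma trace_tensFam {D k : ℕ} (M : Fin k → Matrix (Fin D) (Fin D) ℂ) :
    (tensFam M).trace = ∏ j, (M j).trace := by
  simp only [Matrix.trace, Matrix.diag_apply, tensFam_apply]
  exact (Fintype.prod_sum fun j a => M j a a).symm

lemma trace_tensPow {D : ℕ} (k : ℕ) (ρ : Matrix (Fin D) (Fin D) ℂ) :
    (tensPow k ρ).trace = ρ.trace ^ k := by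
  simp [tensPow, trace_tensFam]

lemma ptraceL_kronecker {D n m : ℕ} (A : Matrix (Fin n → Fin D) (Fin n → Fin D) ℂ)
    (B : Matrix (Fin m → Fin D) (Fin m → Fin D) ℂ) :
    ptraceL (A ⊗ₖ B) = A.trace • B := by
  ext y y'
  simp [ptraceL, Matrix.trace, Finset.sum_mul]

lemma ptraceL_add {D n m : ℕ} (A B : Matrix ((Fin n → Fin D) × (Fin m → Fin D))
    ((Fin n → Fin D) × (Fin m → Fin D)) ℂ) :
    ptraceL (A + B) = ptraceL A + ptraceL B := by
  ext y y'
  simp [ptraceL, Finset.sum_add_distrib]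

lemma ptraceL_smul {D n m : ℕ} (c : ℂ) (A : Matrix ((Fin n → Fin D) × (Fin m → Fin D))
    ((Fin n → Fin D) × (Fin m → Fin D)) ℂ) :
    ptraceL (c • A) = c • ptraceL A := by
  ext y y'
  simp [ptraceL, Finset.mul_sum]

lemma ptraceL_sum {D n m : ℕ} {ι : Type*} (s : Finset ι)
    (A : ι → Matrix ((Fin n → Fin D) × (Fin m → Fin D))
      ((Fin n → Fin D) × (Fin m → Fin D)) ℂ) :
    ptraceL (∑ i ∈ s, A i) = ∑ i ∈ s, ptraceL (A i) := by
  ext y y'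
  simp only [ptraceL, Matrix.of_apply, Matrix.sum_apply]
  exact Finset.sum_comm

/-- Tracing out the output registers of the joint final state returns the catalyst
`ω = (1/n) Σ_{i=0}^{n-1} ρ^{⊗i} ⊗ σ^{⊗(n-1-i)}` exactly in its initial state. -/
theorem catalyst_returned_exactly {D n : ℕ} (hn : 1 ≤ n)
    (ρ σ : Matrix (Fin D) (Fin D) ℂ)
    (hρ : ρ.PosSemidef) (hρtr : ρ.trace = 1)
    (hσ : σ.PosSemidef) (hσtr : σ.trace = 1) :
    ptraceL (tauFull n ρ σ)
      = ((n : ℂ)⁻¹) • ∑ i ∈ Finset.range n,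
          tensFam (fun j : Fin (n - 1) => if (j : ℕ) < i then ρ else σ) := by
  obtain ⟨m, rfl⟩ := Nat.exists_eq_add_of_le' hn
  simp only [tauFull, ptraceL_smul, ptraceL_add, ptraceL_sum, ptraceL_kronecker, trace_tensPow,
    hρtr, hσtr, one_pow, one_smul]
  rw [Finset.sum_range_succ', add_comm (tensPow _ σ)]
  simp [tensPow]
end

section
/- Let ρ be a nonzero positive semidefinite matrix on ℂ^a ⊗ ℂ^d ⊗ ℂ^b (registers A, C, B). Then SN of ρ with respect to the bipartition (A C)|B is at most d times SN of ρ with respect to the bipartition A|(C B), where in each case the three tensor factors are regrouped accordingly. -/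
open Matrix
open scoped ComplexOrder

/-- Schmidt rank of a vector `ψ ∈ H_A ⊗ H_B`: the rank of the matrix of its
coefficients in the standard product basis. -/
noncomputable def schmidtRank {A B : Type*} [Fintype A] [Fintype B]
    (ψ : A × B → ℂ) : ℕ :=
  (Matrix.of fun i j => ψ (i, j)).rank

/-- Schmidt number of a matrix on `H_A ⊗ H_B`: the minimum over all finite
decompositions `ρ = Σ_i ψᵢ ψᵢ†` into nonzero vectors of the maximal Schmidt rank
appearing in the decomposition. -/
noncomputable def SN {A B : Type*} [Fintype A] [Fintype B]
    (ρ : Matrix (A × B) (A × B) ℂ) : ℕ :=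
  sInf { d | ∃ (k : ℕ) (ψ : Fin k → (A × B → ℂ)),
    (∀ i, ψ i ≠ 0) ∧ ρ = ∑ i, Matrix.vecMulVec (ψ i) (star (ψ i)) ∧
    ∀ i, schmidtRank (ψ i) ≤ d }

theorem Matrix.rank_add_le {m n K : Type*} [Fintype m] [Fintype n] [Field K]
    (M N : Matrix m n K) : (M + N).rank ≤ M.rank + N.rank := by
  rw [Matrix.rank, Matrix.rank, Matrix.rank, Matrix.mulVecLin_add]
  refine (Submodule.finrank_mono ?_).trans (Submodule.finrank_add_le_finrank_add_finrank _ _)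
  exact LinearMap.range_add_le _ _

theorem Matrix.rank_sum_le {ι m n K : Type*} [Fintype m] [Fintype n] [Field K]
    (s : Finset ι) (M : ι → Matrix m n K) : (∑ i ∈ s, M i).rank ≤ ∑ i ∈ s, (M i).rank := by
  classical
  induction s using Finset.induction_on with
  | empty => simp
  | insert i s hi ih =>
    rw [Finset.sum_insert hi, Finset.sum_insert hi]
    exact (Matrix.rank_add_le _ _).trans (Nat.add_le_add_left ih _)

/-- Moving a tensor factor `C` to the other side of the bipartition multiplies the Schmidt rank
of a vector by at most `dim C`. -/
theorem schmidtRank_assoc_le {A B C : Type*} [Fintype A] [Fintype B] [Fintype C]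
    (ψ : A × C × B → ℂ) :
    schmidtRank (fun x : (A × C) × B => ψ (x.1.1, x.1.2, x.2))
      ≤ Fintype.card C * schmidtRank ψ := by
  classical
  set M : Matrix A (C × B) ℂ := Matrix.of fun i j => ψ (i, j) with hM
  let P (c : C) : Matrix (A × C) A ℂ := Matrix.of fun x i => if x = (i, c) then 1 else 0
  have key : (Matrix.of fun (i : A × C) (j : B) => ψ (i.1, i.2, j))
      = ∑ c, P c * M.submatrix id (Prod.mk c) := by
    ext ⟨i, c⟩ j
    simp [Matrix.sum_apply, Matrix.mul_apply, P, hM, ite_and]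
  calc schmidtRank (fun x : (A × C) × B => ψ (x.1.1, x.1.2, x.2))
      = (∑ c, P c * M.submatrix id (Prod.mk c)).rank := congrArg Matrix.rank key
    _ ≤ ∑ c, (P c * M.submatrix id (Prod.mk c)).rank := Matrix.rank_sum_le _ _
    _ ≤ ∑ _c : C, M.rank := Finset.sum_le_sum fun c _ =>
        (Matrix.rank_mul_le_right _ _).trans (Matrix.rank_submatrix_le _ _ _)
    _ = Fintype.card C * schmidtRank ψ := by simp [schmidtRank, hM]

/-- A positive semidefinite matrix is a finite sum of terms `ψ ψ†` with `ψ ≠ 0`. -/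
theorem Matrix.PosSemidef.exists_eq_sum_vecMulVec_ne_zero {n : Type*} [Finite n]
    {M : Matrix n n ℂ} (hM : M.PosSemidef) :
    ∃ (k : ℕ) (ψ : Fin k → n → ℂ),
      (∀ i, ψ i ≠ 0) ∧ M = ∑ i, Matrix.vecMulVec (ψ i) (star (ψ i)) := by
  classical
  obtain ⟨m, v, hv⟩ := Matrix.posSemidef_iff_eq_sum_vecMulVec.mp hM
  let e := Fintype.equivFin {i // v i ≠ 0}
  refine ⟨_, fun i => v (e.symm i), fun i => (e.symm i).2, ?_⟩
  rw [hv, e.symm.sum_comp fun i : {i // v i ≠ 0} => Matrix.vecMulVec (v i) (star (v i)),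
    ← Finset.sum_subtype (Finset.univ.filter fun i => v i ≠ 0) (fun i => by simp)
      fun i => Matrix.vecMulVec (v i) (star (v i))]
  symm
  refine Finset.sum_filter_of_ne fun i _ hi h => hi ?_
  simp [h]

/-- The Schmidt number of a positive semidefinite matrix is attained by some decomposition. -/
theorem Matrix.PosSemidef.exists_schmidtRank_le_SN {A B : Type*} [Fintype A] [Fintype B]
    {ρ : Matrix (A × B) (A × B) ℂ} (hρ : ρ.PosSemidef) :
    ∃ (k : ℕ) (ψ : Fin k → (A × B → ℂ)),
      (∀ i, ψ i ≠ 0) ∧ ρ = ∑ i, Matrix.vecMulVec (ψ i) (star (ψ i)) ∧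
      ∀ i, schmidtRank (ψ i) ≤ SN ρ := by
  obtain ⟨k, ψ, hψ, h⟩ := hρ.exists_eq_sum_vecMulVec_ne_zero
  exact Nat.sInf_mem (s := { d | ∃ (k : ℕ) (ψ : Fin k → (A × B → ℂ)),
    (∀ i, ψ i ≠ 0) ∧ ρ = ∑ i, Matrix.vecMulVec (ψ i) (star (ψ i)) ∧
    ∀ i, schmidtRank (ψ i) ≤ d }) ⟨Finset.univ.sup fun i => schmidtRank (ψ i), k, ψ, hψ, h,
    fun i => Finset.le_sup (f := fun i => schmidtRank (ψ i)) (Finset.mem_univ i)⟩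

/-- Mixed-state communication bound: for a state on three registers `A, C, B`
with `dim C = d`, the Schmidt number across the bipartition `(A C)|B` is at most
`d` times the Schmidt number across `A|(C B)`. -/
theorem SN_shift_register {a d b : ℕ}
    (ρ : Matrix (Fin a × Fin d × Fin b) (Fin a × Fin d × Fin b) ℂ)
    (hρ : ρ.PosSemidef) (hρ0 : ρ ≠ 0) :
    SN (Matrix.of fun x y : (Fin a × Fin d) × Fin b =>
          ρ (x.1.1, x.1.2, x.2) (y.1.1, y.1.2, y.2))
      ≤ d * SN (Matrix.of fun x y : Fin a × (Fin d × Fin b) =>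
          ρ (x.1, x.2.1, x.2.2) (y.1, y.2.1, y.2.2)) := by
  obtain ⟨k, ψ, hψ, hsum, hrank⟩ := Matrix.PosSemidef.exists_schmidtRank_le_SN hρ
  refine Nat.sInf_le ⟨k, fun i x => ψ i (x.1.1, x.1.2, x.2), fun i h => hψ i ?_, ?_, fun i => ?_⟩
  · ext ⟨x, c, y⟩
    exact congrFun h ((x, c), y)
  · ext x y
    rw [Matrix.of_apply, hsum]
    simp [Matrix.sum_apply, Matrix.vecMulVec_apply]
  · simpa only [Fintype.card_fin] using!
      (schmidtRank_assoc_le (ψ i)).trans (Nat.mul_le_mul_left _ (hrank i))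
end

section
/- Let n ≥ 1, let |Φ+⟩ = (e_0 ⊗ e_0 + e_1 ⊗ e_1)/√2 ∈ ℂ³ ⊗ ℂ³, and define the density matrix τ = (1/(n+1)) · (|Φ+⟩⟨Φ+|)^{⊗(n+1)} + (n/(n+1)) · ((e_2⊗e_2)(e_2⊗e_2)†)^{⊗(n+1)} on (ℂ³ ⊗ ℂ³)^{⊗(n+1)}, regarded under the A|B bipartition as a matrix on (ℂ³)^{⊗(n+1)} ⊗ (ℂ³)^{⊗(n+1)}. Then SN(τ) = 2^{n+1}, while SN(|Φ+⟩⟨Φ+|) = 2; hence the transformation |Φ+⟩⟨Φ+| → τ multiplies the Schmidt number by exactly 2^n. -/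
open Matrix

/-- The maximally entangled two-qubit state `|Φ+⟩ ∈ ℂ³ ⊗ ℂ³`. -/
noncomputable def phi3 : Fin 3 × Fin 3 → ℂ :=
  fun p => if p.1 = p.2 ∧ (p.1 : ℕ) < 2 then ((Real.sqrt 2)⁻¹ : ℝ) else 0

/-- The product vector `e₂ ⊗ e₂ ∈ ℂ³ ⊗ ℂ³`. -/
noncomputable def e22v : Fin 3 × Fin 3 → ℂ :=
  fun p => if p.1 = 2 ∧ p.2 = 2 then 1 else 0

/-- The projector `|Φ+⟩⟨Φ+|`. -/
noncomputable def Pphi : Matrix (Fin 3 × Fin 3) (Fin 3 × Fin 3) ℂ :=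
  Matrix.vecMulVec phi3 (star phi3)

/-- The projector `(e₂⊗e₂)(e₂⊗e₂)†`. -/
noncomputable def Q22 : Matrix (Fin 3 × Fin 3) (Fin 3 × Fin 3) ℂ :=
  Matrix.vecMulVec e22v (star e22v)

/-- Tensor product of a family of matrices on `ℂ³ ⊗ ℂ³`, regrouped under the A|B
bipartition as a matrix on `(ℂ³)^{⊗m} ⊗ (ℂ³)^{⊗m}`. -/
noncomputable def pairTens {m : ℕ}
    (f : Fin m → Matrix (Fin 3 × Fin 3) (Fin 3 × Fin 3) ℂ) :
    Matrix ((Fin m → Fin 3) × (Fin m → Fin 3)) ((Fin m → Fin 3) × (Fin m → Fin 3)) ℂ :=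
  Matrix.of fun x y => ∏ j, f j (x.1 j, x.2 j) (y.1 j, y.2 j)

/-- The target state `τ = (1/(n+1)) |Φ+⟩⟨Φ+|^{⊗(n+1)} + (n/(n+1)) (e₂e₂†)^{⊗(n+1)}`
of Theorem 1, under the A|B bipartition. -/
noncomputable def tau (n : ℕ) :
    Matrix ((Fin (n + 1) → Fin 3) × (Fin (n + 1) → Fin 3))
           ((Fin (n + 1) → Fin 3) × (Fin (n + 1) → Fin 3)) ℂ :=
  (((n : ℂ) + 1)⁻¹) • pairTens (fun _ : Fin (n + 1) => Pphi)
    + ((n : ℂ) / ((n : ℂ) + 1)) • pairTens (fun _ : Fin (n + 1) => Q22)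

section SchmidtNumber

variable {A B ι : Type*} [Fintype A] [Fintype B] [Fintype ι]

/-- A factorization of the coefficient matrix through `ι` bounds the Schmidt rank. -/
lemma schmidtRank_le_card_of_factor (ψ : A × B → ℂ) (F : A → ι → ℂ) (G : ι → B → ℂ)
    (h : ∀ i j, ψ (i, j) = ∑ s, F i s * G s j) : schmidtRank ψ ≤ Fintype.card ι := by
  have hM : (Matrix.of fun i j => ψ (i, j)) = Matrix.of F * Matrix.of G := by
    ext i j
    simp [Matrix.mul_apply, h]
  rw [schmidtRank, hM]
  exact (Matrix.rank_mul_le_left _ _).trans (Matrix.rank_le_card_width _)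

/-- A nonzero scalar block in the coefficient matrix bounds the Schmidt rank from below. -/
lemma card_le_schmidtRank_of_block [DecidableEq ι] (ψ : A × B → ℂ) (f : ι → A) (g : ι → B)
    (c : ℂ) (hc : c ≠ 0) (h : ∀ x y, ψ (f x, g y) = if x = y then c else 0) :
    Fintype.card ι ≤ schmidtRank ψ := by
  have hM : (Matrix.of fun i j => ψ (i, j)).submatrix f g = c • (1 : Matrix ι ι ℂ) := by
    ext x y
    simp [h, Matrix.one_apply]
  have hr : (c • (1 : Matrix ι ι ℂ)).rank = Fintype.card ι := by
    apply Matrix.rank_of_isUnit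
    exact (isUnit_one).smul (Units.mk0 c hc)
  rw [← hr, ← hM]
  exact Matrix.rank_submatrix_le _ _ _

lemma sum_vecMulVec_star_apply {C : Type*} {k : ℕ} (ψ : Fin k → C → ℂ) (p q : C) :
    (∑ i, Matrix.vecMulVec (ψ i) (star (ψ i))) p q = ∑ i, ψ i p * star (ψ i q) := by
  simp [Matrix.sum_apply, Matrix.vecMulVec_apply]

open ComplexOrder in
lemma eq_zero_of_sum_mul_star_eq_zero {k : ℕ} {z : Fin k → ℂ}
    (h : ∑ i, z i * star (z i) = 0) (i : Fin k) : z i = 0 := by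
  exact congrFun (dotProduct_self_star_eq_zero.mp h) i

/-- A matrix containing an unnormalized maximally entangled block indexed by `ι` has only
decompositions in which some vector has Schmidt rank at least `card ι`. -/
lemma card_le_of_entangled_block [DecidableEq ι] [Nonempty ι]
    (ρ : Matrix (A × B) (A × B) ℂ) (f : ι → A) (g : ι → B) (c : ℂ) (hc : c ≠ 0)
    (h : ∀ x y x' y', ρ (f x, g y) (f x', g y') = if x = y ∧ x' = y' then c else 0)
    {d k : ℕ} (ψ : Fin k → (A × B → ℂ))
    (hρ : ρ = ∑ i, Matrix.vecMulVec (ψ i) (star (ψ i)))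
    (hd : ∀ i, schmidtRank (ψ i) ≤ d) : Fintype.card ι ≤ d := by
  have hsum (p q : A × B) : ∑ i, ψ i p * star (ψ i q) = ρ p q := by
    rw [hρ, sum_vecMulVec_star_apply]
  have hoff (x y : ι) (hxy : x ≠ y) (i : Fin k) : ψ i (f x, g y) = 0 :=
    eq_zero_of_sum_mul_star_eq_zero (z := fun i => ψ i (f x, g y))
      (by rw [hsum, h]; simp [hxy]) i
  have hdiag (x y : ι) (i : Fin k) : ψ i (f x, g x) = ψ i (f y, g y) := by
    refine sub_eq_zero.mp (eq_zero_of_sum_mul_star_eq_zero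
      (z := fun i => ψ i (f x, g x) - ψ i (f y, g y)) ?_ i)
    simp only [star_sub, sub_mul, mul_sub, Finset.sum_sub_distrib, hsum, h]
    simp
  obtain ⟨x₀⟩ := ‹Nonempty ι›
  obtain ⟨i, hi⟩ : ∃ i, ψ i (f x₀, g x₀) ≠ 0 := by
    by_contra! hz
    apply hc
    have := hsum (f x₀, g x₀) (f x₀, g x₀)
    rw [h] at this
    simpa [hz] using this.symm
  refine (card_le_schmidtRank_of_block (ψ i) f g _ hi fun x y => ?_).trans (hd i)
  split_ifs with hxy
  · rw [hxy, hdiag]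
  · exact hoff x y hxy i

/-- The Schmidt number is `card ι` as soon as the matrix contains a maximally entangled block
indexed by `ι` and has a decomposition into vectors of Schmidt rank at most `card ι`. -/
lemma SN_eq_card [DecidableEq ι] [Nonempty ι]
    (ρ : Matrix (A × B) (A × B) ℂ) (f : ι → A) (g : ι → B) (c : ℂ) (hc : c ≠ 0)
    (h : ∀ x y x' y', ρ (f x, g y) (f x', g y') = if x = y ∧ x' = y' then c else 0)
    {k : ℕ} (ψ : Fin k → (A × B → ℂ)) (hψ : ∀ i, ψ i ≠ 0)
    (hρ : ρ = ∑ i, Matrix.vecMulVec (ψ i) (star (ψ i)))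
    (hd : ∀ i, schmidtRank (ψ i) ≤ Fintype.card ι) : SN ρ = Fintype.card ι := by
  refine le_antisymm (Nat.sInf_le ⟨k, ψ, hψ, hρ, hd⟩) (le_csInf ⟨_, k, ψ, hψ, hρ, hd⟩ ?_)
  rintro d ⟨l, χ, -, hχ, hle⟩
  exact card_le_of_entangled_block ρ f g c hc h χ hχ hle

end SchmidtNumber

/-- The `m`-fold tensor power of a vector in `ℂ³ ⊗ ℂ³`, regrouped under the A|B bipartition. -/
def pairPow (m : ℕ) (φ : Fin 3 × Fin 3 → ℂ) : (Fin m → Fin 3) × (Fin m → Fin 3) → ℂ :=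
  fun p => ∏ j, φ (p.1 j, p.2 j)

lemma pairTens_vecMulVec (m : ℕ) (φ : Fin 3 × Fin 3 → ℂ) :
    pairTens (fun _ : Fin m => Matrix.vecMulVec φ (star φ))
      = Matrix.vecMulVec (pairPow m φ) (star (pairPow m φ)) := by
  ext p q
  simp [pairTens, pairPow, Matrix.vecMulVec_apply, Finset.prod_mul_distrib]

lemma schmidtRank_smul_pairPow_le {ι : Type*} [Fintype ι] (m : ℕ) (c : ℂ)
    (φ : Fin 3 × Fin 3 → ℂ) (F : Fin 3 → ι → ℂ) (G : ι → Fin 3 → ℂ)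
    (h : ∀ i j, φ (i, j) = ∑ s, F i s * G s j) :
    schmidtRank (c • pairPow m φ) ≤ Fintype.card (Fin m → ι) := by
  classical
  refine schmidtRank_le_card_of_factor _ (fun x s => c * ∏ j, F (x j) (s j))
    (fun s y => ∏ j, G (s j) (y j)) fun x y => ?_
  simp only [Pi.smul_apply, smul_eq_mul, pairPow, h, Finset.prod_univ_sum,
    Fintype.piFinset_univ, Finset.mul_sum, Finset.prod_mul_distrib, mul_assoc]

lemma phi3_castSucc (x y : Fin 2) :
    phi3 (x.castSucc, y.castSucc) = if x = y then ((Real.sqrt 2)⁻¹ : ℂ) else 0 := by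
  fin_cases x <;> fin_cases y <;> simp [phi3]

lemma e22v_castSucc (x y : Fin 2) : e22v (x.castSucc, y.castSucc) = 0 := by
  fin_cases x <;> simp [e22v]

lemma phi3_factor (i j : Fin 3) :
    phi3 (i, j) = ∑ s : Fin 2, phi3 (i, s.castSucc) * (if s.castSucc = j then 1 else 0) := by
  fin_cases i <;> fin_cases j <;> simp [phi3]

lemma e22v_factor (i j : Fin 3) :
    e22v (i, j) = ∑ s : Fin 2, (if i = 2 ∧ s = 0 then 1 else 0) * (if j = 2 then 1 else 0) := by
  fin_cases i <;> fin_cases j <;> simp [e22v]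

lemma pairPow_phi3_castSucc (m : ℕ) (x y : Fin m → Fin 2) :
    pairPow m phi3 (fun j => (x j).castSucc, fun j => (y j).castSucc)
      = if x = y then ((Real.sqrt 2)⁻¹ : ℂ) ^ m else 0 := by
  simp only [pairPow, phi3_castSucc]
  split_ifs with h
  · simp [h]
  · obtain ⟨j, hj⟩ := Function.ne_iff.mp h
    exact Finset.prod_eq_zero (Finset.mem_univ j) (if_neg hj)

lemma pairPow_e22v_castSucc (m : ℕ) (x y : Fin (m + 1) → Fin 2) :
    pairPow (m + 1) e22v (fun j => (x j).castSucc, fun j => (y j).castSucc) = 0 := by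
  simp [pairPow, e22v_castSucc]

lemma pairPow_phi3_ne_zero (m : ℕ) : pairPow m phi3 ≠ 0 := fun h => by
  have := congrFun h (fun _ => Fin.castSucc 0, fun _ => Fin.castSucc 0)
  rw [pairPow_phi3_castSucc m (fun _ => 0) (fun _ => 0)] at this
  simp at this

lemma pairPow_e22v_ne_zero (m : ℕ) : pairPow m e22v ≠ 0 := fun h => by
  simpa [pairPow, e22v] using congrFun h (fun _ => 2, fun _ => 2)

lemma vecMulVec_sqrt_smul {A : Type*} (r : ℝ) (hr : 0 ≤ r) (ψ : A → ℂ) :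
    Matrix.vecMulVec ((Real.sqrt r : ℂ) • ψ) (star ((Real.sqrt r : ℂ) • ψ))
      = (r : ℂ) • Matrix.vecMulVec ψ (star ψ) := by
  have h : (Real.sqrt r : ℂ) * (Real.sqrt r : ℂ) = r := by
    rw [← Complex.ofReal_mul, Real.mul_self_sqrt hr]
  ext p q
  simp only [Matrix.vecMulVec_apply, Pi.smul_apply, Pi.star_apply, smul_eq_mul, star_mul',
    Matrix.smul_apply, ← h]
  simp
  ring

lemma tau_eq (n : ℕ) :
    tau n = (((n : ℂ) + 1)⁻¹) • Matrix.vecMulVec (pairPow (n + 1) phi3)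
        (star (pairPow (n + 1) phi3))
      + ((n : ℂ) / ((n : ℂ) + 1)) • Matrix.vecMulVec (pairPow (n + 1) e22v)
        (star (pairPow (n + 1) e22v)) := by
  simp only [tau, Pphi, Q22, pairTens_vecMulVec]

lemma SN_Pphi : SN Pphi = 2 := by
  have h := SN_eq_card (ι := Fin 2) Pphi Fin.castSucc Fin.castSucc
    ((Real.sqrt 2 : ℂ)⁻¹ * (Real.sqrt 2 : ℂ)⁻¹) (by simp) ?_ (fun _ : Fin 1 => phi3) ?_
    (by simp [Pphi]) fun _ => schmidtRank_le_card_of_factor _ _ _ phi3_factor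
  · simpa using h
  · intro x y x' y'
    simp only [Pphi, Matrix.vecMulVec_apply, Pi.star_apply, phi3_castSucc]
    by_cases h₁ : x = y <;> by_cases h₂ : x' = y' <;> simp [h₁, h₂]
  · intro _ h
    simpa [phi3] using congrFun h (0, 0)

lemma SN_tau (n : ℕ) (hn : 1 ≤ n) : SN (tau n) = 2 ^ (n + 1) := by
  have hn0 : (n : ℝ) ≠ 0 := by positivity
  have hn1 : (n : ℂ) + 1 ≠ 0 := by exact_mod_cast n.succ_ne_zero
  have h := SN_eq_card (ι := Fin (n + 1) → Fin 2) (tau n)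
    (fun x j => (x j).castSucc) (fun x j => (x j).castSucc)
    (((n : ℂ) + 1)⁻¹ * (((Real.sqrt 2 : ℂ)⁻¹) ^ (n + 1) * ((Real.sqrt 2 : ℂ)⁻¹) ^ (n + 1)))
    (by simp [hn1]) ?_
    ![(Real.sqrt ((n : ℝ) + 1)⁻¹ : ℂ) • pairPow (n + 1) phi3,
      (Real.sqrt ((n : ℝ) / ((n : ℝ) + 1)) : ℂ) • pairPow (n + 1) e22v] ?_ ?_ ?_
  · simpa using h
  · intro x y x' y'
    simp only [tau_eq, Matrix.add_apply, Matrix.smul_apply, Matrix.vecMulVec_apply, Pi.star_apply,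
      pairPow_phi3_castSucc, pairPow_e22v_castSucc]
    by_cases h₁ : x = y <;> by_cases h₂ : x' = y' <;> simp [h₁, h₂]
  · rw [Fin.forall_fin_two]
    refine ⟨smul_ne_zero ?_ (pairPow_phi3_ne_zero _), smul_ne_zero ?_ (pairPow_e22v_ne_zero _)⟩
    · exact Complex.ofReal_ne_zero.mpr (Real.sqrt_pos.mpr (by positivity)).ne'
    · exact Complex.ofReal_ne_zero.mpr (Real.sqrt_pos.mpr (by positivity)).ne'
  · rw [Fin.sum_univ_two, tau_eq]
    simp only [Matrix.cons_val_zero, Matrix.cons_val_one]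
    rw [vecMulVec_sqrt_smul _ (by positivity), vecMulVec_sqrt_smul _ (by positivity)]
    push_cast
    rfl
  · rw [Fin.forall_fin_two]
    exact ⟨schmidtRank_smul_pairPow_le _ _ _ _ _ phi3_factor,
      schmidtRank_smul_pairPow_le _ _ _ _ _ e22v_factor⟩

/-- Quantitative core of Theorem 1: the target state `τ` has Schmidt number
exactly `2^{n+1}`, while the input `|Φ+⟩⟨Φ+|` has Schmidt number `2`; hence the
catalytic transformation multiplies the Schmidt number by exactly `2^n`. -/
theorem tau_schmidt_number_eq (n : ℕ) (hn : 1 ≤ n) :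
    SN (tau n) = 2 ^ (n + 1) ∧ SN Pphi = 2 :=
  ⟨SN_tau n hn, SN_Pphi⟩
end
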